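/- arXiv:1908.11690 — 3 statements merged into one kernel-verified Lean document; each statement's English description precedes it below -/
import Mathlib

section
/- Let d ∈ {3, 11, 19, 43, 67, 163} and let O_K be the ring of integers of K = Q(√−d). Then the unit group of the quotient ring O_K/8O_K is isomorphic, as an abstract group, to (Z/2Z)² × Z/12Z. -/
open NumberField

/-- The ring `(ℤ/8ℤ)[ω]` with `ω² = ω - 1`, the Galois ring of order `64` and characteristic `8`. -/
abbrev GaloisRingEight : Type := QuadraticAlgebra (ZMod 8) (-1) 1

namespace GaloisRingEight

/-- The units of `(ℤ/8ℤ)[ω]` in terms of the generators `-1`, `1 + 4ω` and `-1 - ω`. -/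
def unitOf (p : (ZMod 2 × ZMod 2) × ZMod 12) : GaloisRingEight :=
  (-1) ^ p.1.1.val * (⟨1, 4⟩ : GaloisRingEight) ^ p.1.2.val *
    (⟨-1, -1⟩ : GaloisRingEight) ^ p.2.val

theorem unitOf_add : ∀ p q, unitOf (p + q) = unitOf p * unitOf q := by
  decide +kernel

theorem eq_zero_of_unitOf_eq_one : ∀ p, unitOf p = 1 → p = 0 := by
  decide +kernel

theorem four_mul_eq_zero_or_exists_unitOf_eq (z : GaloisRingEight) :
    4 * z = 0 ∨ ∃ p, unitOf p = z := by
  have h : ∀ a b : ZMod 8, 4 * (⟨a, b⟩ : GaloisRingEight) = 0 ∨ ∃ p, unitOf p = ⟨a, b⟩ := by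
    decide +kernel
  exact h z.re z.im

theorem exists_mul_eq_four (z : GaloisRingEight) (hz : z ≠ 0) : ∃ y, y * z = 4 := by
  have h : ∀ a b : ZMod 8, (⟨a, b⟩ : GaloisRingEight) = 0 ∨
      ∃ c d : ZMod 8, (⟨c, d⟩ : GaloisRingEight) * ⟨a, b⟩ = 4 := by
    decide +kernel
  obtain h | ⟨c, d, h⟩ := h z.re z.im
  · exact absurd h hz
  · exact ⟨_, h⟩

theorem nat_card : Nat.card GaloisRingEight = 64 := by
  rw [Nat.card_congr (QuadraticAlgebra.equivProd _ _), Nat.card_prod, Nat.card_zmod]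

/-- `unitOf` as a homomorphism to the unit group. -/
def unitsHom : Multiplicative ((ZMod 2 × ZMod 2) × ZMod 12) →* GaloisRingEightˣ :=
  MonoidHom.toHomUnits
    { toFun p := unitOf p.toAdd
      map_one' := by decide +kernel
      map_mul' p q := unitOf_add p.toAdd q.toAdd }

theorem coe_unitsHom (p : Multiplicative ((ZMod 2 × ZMod 2) × ZMod 12)) :
    (unitsHom p : GaloisRingEight) = unitOf p.toAdd := rfl

theorem unitsHom_bijective : Function.Bijective unitsHom := by
  refine ⟨(injective_iff_map_eq_one _).2 fun p hp => ?_, fun u => ?_⟩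
  · exact eq_zero_of_unitOf_eq_one p.toAdd (by rw [← coe_unitsHom, hp, Units.val_one])
  · obtain h | ⟨p, hp⟩ := four_mul_eq_zero_or_exists_unitOf_eq u
    · exact absurd ((Units.mul_left_eq_zero u).1 h) (by decide +kernel)
    · exact ⟨.ofAdd p, Units.ext hp⟩

/-- The unit group of `(ℤ/8ℤ)[ω]` is `(ℤ/2ℤ)² × ℤ/12ℤ`. -/
noncomputable def unitsEquiv :
    GaloisRingEightˣ ≃* Multiplicative ((ZMod 2 × ZMod 2) × ZMod 12) :=
  (MulEquiv.ofBijective unitsHom unitsHom_bijective).symm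

/-- A ring with `64` elements in which `8 = 0 ≠ 4` and `X² - X + 1` has a root is `(ℤ/8ℤ)[ω]`. -/
theorem nonempty_ringEquiv {R : Type*} [CommRing R] (hcard : Nat.card R = 64)
    (h8 : (8 : R) = 0) (h4 : (4 : R) ≠ 0) (w : R) (hw : w * w = w - 1) :
    Nonempty (GaloisRingEight ≃+* R) := by
  have hchar : CharP R 8 := by
    have h : addOrderOf (1 : R) = 2 ^ (2 + 1) :=
      addOrderOf_eq_prime_pow (by norm_num [h4]) (by norm_num; exact h8)
    have := CharP.addOrderOf_one R
    rwa [h] at this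
  let _ : Algebra (ZMod 8) R := (ZMod.castHom dvd_rfl R).toAlgebra
  let f : GaloisRingEight →ₐ[ZMod 8] R :=
    QuadraticAlgebra.lift ⟨w, by rw [hw, neg_smul, one_smul, one_smul]; ring⟩
  have hinj : Function.Injective f := by
    refine (injective_iff_map_eq_zero f).2 fun z hz => ?_
    by_contra hne
    obtain ⟨y, hy⟩ := exists_mul_eq_four z hne
    apply h4
    rw [← map_ofNat f 4, ← hy, map_mul, hz, mul_zero]
  have : Finite R := Nat.finite_of_card_ne_zero (by rw [hcard]; norm_num)
  have hbij : Function.Bijective f :=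
    (Nat.bijective_iff_injective_and_card _).2 ⟨hinj, by rw [nat_card, hcard]⟩
  exact ⟨RingEquiv.ofBijective f hbij⟩

end GaloisRingEight

theorem absNorm_span_natCast_of_finrank_eq_two {K : Type*} [Field K] [NumberField K]
    (hdeg : Module.finrank ℚ K = 2) (n : ℕ) :
    Ideal.absNorm (Ideal.span {(n : 𝓞 K)}) = n ^ 2 := by
  have h := Algebra.norm_algebraMap (S := 𝓞 K) (n : ℤ)
  rw [RingOfIntegers.rank, hdeg, map_natCast] at h
  rw [Ideal.absNorm_span_singleton, h]
  simp [Int.natAbs_pow]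

/-- If `d u² ≡ 3 mod 32`, then `(1 + u√-d)/2` is integral and is a root of
`X² - X + 1` modulo `8`. -/
theorem exists_ringOfIntegers_mul_self {K : Type*} [Field K] [NumberField K] {d : ℕ} {sqd : K}
    (hsqd : sqd ^ 2 = -(d : K)) {u c : ℤ} (h : d * u ^ 2 = 3 + 32 * c) :
    ∃ w : 𝓞 K, w * w = w - 1 - 8 * (c : 𝓞 K) := by
  have h' : (d : K) * (u : K) ^ 2 = 3 + 32 * c := mod_cast congrArg (Int.cast : ℤ → K) h
  have hroot : ((1 + u * sqd) / 2) * ((1 + u * sqd) / 2) =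
      (1 + u * sqd) / 2 - 1 - 8 * (c : K) := by
    linear_combination (u : K) ^ 2 / 4 * hsqd - h' / 4
  have hint : IsIntegral ℤ ((1 + u * sqd) / 2) := by
    refine ⟨.X ^ 2 - .X + .C (1 + 8 * c), by monicity!, ?_⟩
    simp only [Polynomial.eval₂_add, Polynomial.eval₂_sub, Polynomial.eval₂_X_pow,
      Polynomial.eval₂_X, Polynomial.eval₂_C]
    simp only [eq_intCast]
    push_cast
    linear_combination hroot
  obtain ⟨w, hw⟩ : ∃ w : 𝓞 K, (w : K) = (1 + u * sqd) / 2 := ⟨⟨_, hint⟩, rfl⟩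
  refine ⟨w, RingOfIntegers.ext ?_⟩
  simpa only [map_mul, map_sub, map_one, map_ofNat, map_intCast, hw] using hroot

/-- For `d ∈ {3, 11, 19, 43, 67, 163}` and `K = ℚ(√−d)`, the unit group of
`𝓞_K/8𝓞_K` is isomorphic, as an abstract group, to `(ℤ/2ℤ)² × ℤ/12ℤ`. -/
theorem units_of_quotient_by_eight_iso
    (d : ℕ) (hd : d = 3 ∨ d = 11 ∨ d = 19 ∨ d = 43 ∨ d = 67 ∨ d = 163)
    (K : Type*) [Field K] [NumberField K] (hdeg : Module.finrank ℚ K = 2)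
    (sqd : K) (hsqd : sqd ^ 2 = -(d : K)) :
    Nonempty ((𝓞 K ⧸ Ideal.span {(8 : 𝓞 K)})ˣ ≃*
      Multiplicative ((ZMod 2 × ZMod 2) × ZMod 12)) := by
  obtain ⟨u, c, huc⟩ : ∃ u c : ℤ, d * u ^ 2 = 3 + 32 * c := by
    rcases hd with rfl | rfl | rfl | rfl | rfl | rfl
    exacts [⟨1, 0, by norm_num⟩, ⟨3, 3, by norm_num⟩, ⟨7, 29, by norm_num⟩,
      ⟨3, 12, by norm_num⟩, ⟨1, 2, by norm_num⟩, ⟨1, 5, by norm_num⟩]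
  obtain ⟨w, hw⟩ := exists_ringOfIntegers_mul_self hsqd huc
  have hnorm8 := absNorm_span_natCast_of_finrank_eq_two hdeg 8
  have hnorm4 := absNorm_span_natCast_of_finrank_eq_two hdeg 4
  push_cast at hnorm8 hnorm4
  let π := Ideal.Quotient.mk (Ideal.span {(8 : 𝓞 K)})
  have h8 : π 8 = 0 := Ideal.Quotient.eq_zero_iff_mem.2 (Ideal.mem_span_singleton_self 8)
  have h4 : π 4 ≠ 0 := fun h => by
    have hdvd := Ideal.absNorm_dvd_absNorm_of_le
      ((Ideal.span_singleton_le_iff_mem _).2 (Ideal.Quotient.eq_zero_iff_mem.1 h))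
    rw [hnorm8, hnorm4] at hdvd
    norm_num at hdvd
  have hπw : π w * π w = π w - 1 := by
    rw [← map_mul, hw, map_sub, map_sub, map_mul, h8, map_one, zero_mul, sub_zero]
  obtain ⟨e⟩ := GaloisRingEight.nonempty_ringEquiv
    (R := 𝓞 K ⧸ Ideal.span {(8 : 𝓞 K)}) hnorm8
    (by rwa [← map_ofNat π 8]) (by rwa [← map_ofNat π 4]) (π w) hπw
  exact ⟨(Units.mapEquiv e.symm.toMulEquiv).trans GaloisRingEight.unitsEquiv⟩
end

section
/- Let d ∈ {3, 11, 19, 43, 67, 163} and let O_K be the ring of integers of K = Q(√−d). Let Φ : O_Kˣ → (O_K/8O_K)ˣ/((O_K/8O_K)ˣ)² be the homomorphism obtained by reducing units of O_K modulo 8O_K and then passing to the quotient by squares. Then the image of Φ is a group of order 2, and the cokernel of Φ is isomorphic to (Z/2Z)² (in particular it has order 4). -/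
open NumberField

theorem card_quotient_range_powMonoidHom_eq_card_ker {G : Type*} [CommGroup G] [Finite G] (n : ℕ) :
    Nat.card (G ⧸ (powMonoidHom n : G →* G).range) =
      Nat.card (powMonoidHom n : G →* G).ker := by
  have h₁ := (powMonoidHom n : G →* G).ker.card_mul_index
  have h₂ := (powMonoidHom n : G →* G).range.card_mul_index
  rw [Subgroup.index_ker, ← h₂, mul_comm] at h₁
  exact (Nat.eq_of_mul_eq_mul_left Nat.card_pos h₁).symm

theorem isKleinFour_of_card_eq_four {G : Type*} [Group G] (hcard : Nat.card G = 4)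
    (hsq : ∀ g : G, g ^ 2 = 1) : IsKleinFour G where
  card_four := hcard
  exponent_two := by
    have : Nontrivial G :=
      have := Nat.finite_of_card_ne_zero (α := G) (by omega)
      (Finite.one_lt_card_iff_nontrivial (α := G)).mp (by omega)
    exact (Nat.dvd_prime Nat.prime_two).mp (Monoid.exponent_dvd_of_forall_pow_eq_one hsq)
      |>.resolve_left fun h => not_subsingleton G (Monoid.exp_eq_one_iff.mp h)

theorem card_range_and_quotient_of_card_ker_sq {U G : Type*} [CommGroup U] [CommGroup G] [Finite G]
    (f : U →* G) (e : U) (hfe : ¬ IsSquare (f e))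
    (hU : ∀ u : U, ∃ v, u = v ^ 2 ∨ u = e * v ^ 2)
    (hker : Nat.card (powMonoidHom 2 : G →* G).ker = 8) :
    let sq : Subgroup G := (powMonoidHom 2 : G →* G).range
    let Φ : U →* G ⧸ sq := (QuotientGroup.mk' sq).comp f
    Nat.card Φ.range = 2 ∧
      Nonempty (((G ⧸ sq) ⧸ Φ.range) ≃* Multiplicative (ZMod 2 × ZMod 2)) ∧
      Nat.card ((G ⧸ sq) ⧸ Φ.range) = 4 := by
  intro sq Φ
  have hsq (x : G ⧸ sq) : x ^ 2 = 1 := by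
    induction x using QuotientGroup.induction_on with
    | H g => exact (QuotientGroup.eq_one_iff _).mpr ⟨g, rfl⟩
  have hΦe : Φ e ≠ 1 := fun h => hfe <| by
    obtain ⟨r, hr⟩ := (QuotientGroup.eq_one_iff _).mp h
    exact ⟨r, by rw [← hr, powMonoidHom_apply, pow_two]⟩
  have hrange : Φ.range = Subgroup.zpowers (Φ e) := by
    apply le_antisymm
    · rintro _ ⟨u, rfl⟩
      obtain ⟨v, rfl | rfl⟩ := hU u
      · rw [map_pow, hsq]; exact one_mem _
      · rw [map_mul, map_pow, hsq, mul_one]; exact Subgroup.mem_zpowers _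
    · rw [Subgroup.zpowers_le]; exact ⟨e, rfl⟩
  have htwo : Nat.card Φ.range = 2 := by
    rw [hrange, Nat.card_zpowers]
    exact orderOf_eq_prime (hsq _) hΦe
  have hfour : Nat.card ((G ⧸ sq) ⧸ Φ.range) = 4 := by
    have h := Φ.range.card_mul_index
    rw [htwo, card_quotient_range_powMonoidHom_eq_card_ker, hker, Subgroup.index] at h
    omega
  have hklein : IsKleinFour ((G ⧸ sq) ⧸ Φ.range) := by
    refine isKleinFour_of_card_eq_four hfour fun x => ?_
    induction x using QuotientGroup.induction_on with
    | H g => rw [← QuotientGroup.mk_pow, hsq, QuotientGroup.mk_one]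
  exact ⟨htwo, IsKleinFour.nonempty_mulEquiv, hfour⟩

theorem NumberField.Units.exists_eq_sq_or_neg_sq {K : Type*} [Field K] [NumberField K]
    (hrank : NumberField.Units.rank K = 0) (hneg : ¬ IsSquare (-1 : (𝓞 K)ˣ)) (u : (𝓞 K)ˣ) :
    ∃ v, u = v ^ 2 ∨ u = -1 * v ^ 2 := by
  have htors (u : (𝓞 K)ˣ) : u ∈ NumberField.Units.torsion K := by
    obtain ⟨⟨ζ, e⟩, h, -⟩ := NumberField.Units.exist_unique_eq_mul_prod K u
    have : IsEmpty (Fin (NumberField.Units.rank K)) := by rw [hrank]; infer_instance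
    rw [h]; simp
  obtain ⟨⟨g, hg⟩, hgen⟩ := IsCyclic.exists_generator (α := NumberField.Units.torsion K)
  have hpow (u : (𝓞 K)ˣ) : ∃ k : ℤ, g ^ k = u := by
    obtain ⟨k, hk⟩ := hgen ⟨u, htors u⟩
    exact ⟨k, congrArg Subtype.val hk⟩
  obtain ⟨m, hm⟩ := hpow (-1)
  obtain ⟨k, rfl⟩ := hpow u
  obtain ⟨l, rfl⟩ : Odd m := by
    rw [← Int.not_even_iff_odd]
    rintro ⟨l, rfl⟩
    exact hneg ⟨g ^ l, by rw [← hm, zpow_add]⟩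
  obtain ⟨j, rfl⟩ | ⟨j, rfl⟩ := Int.even_or_odd k
  · exact ⟨g ^ j, .inl (by rw [sq, zpow_add])⟩
  · refine ⟨g ^ (j - l), .inr ?_⟩
    rw [← hm, ← zpow_natCast, ← zpow_mul, ← zpow_add]
    congr 1
    push_cast
    ring

theorem NumberField.Units.rank_eq_zero_of_sq_eq_neg {K : Type*} [Field K] [NumberField K]
    (hdeg : Module.finrank ℚ K = 2) {d : ℕ} (hd : 0 < d) {x : K} (hx : x ^ 2 = -(d : K)) :
    NumberField.Units.rank K = 0 := by
  have : IsTotallyComplex K := by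
    refine ⟨fun v => ?_⟩
    rw [← InfinitePlace.not_isReal_iff_isComplex]
    intro hv
    have h := congrArg (InfinitePlace.embedding_of_isReal hv) hx
    simp only [map_pow, map_neg, map_natCast] at h
    have : (0 : ℝ) < d := by exact_mod_cast hd
    nlinarith [sq_nonneg (InfinitePlace.embedding_of_isReal hv x)]
  have h := IsTotallyComplex.finrank (K := K)
  rw [NumberField.Units.rank, InfinitePlace.card_eq_nrRealPlaces_add_nrComplexPlaces,
    IsTotallyComplex.nrRealPlaces_eq_zero]
  omega


theorem QuadraticAlgebra.exists_mul_eq_four_zmod_eight {c : ZMod 8} (hc : c * 4 = 4)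
    {z : QuadraticAlgebra (ZMod 8) (-c) 1} (hz : z ≠ 0) : ∃ w, z * w = 4 := by
  have key : ∀ c : ZMod 8, c * 4 = 4 → ∀ a b : ZMod 8, (a ≠ 0 ∨ b ≠ 0) →
      ∃ a' b' : ZMod 8, (⟨a, b⟩ * ⟨a', b'⟩ : QuadraticAlgebra (ZMod 8) (-c) 1) = ⟨4, 0⟩ := by
    decide +kernel
  obtain ⟨a', b', h⟩ := key c hc z.re z.im (by
    contrapose! hz
    exact QuadraticAlgebra.ext hz.1 hz.2)
  exact ⟨⟨a', b'⟩, h⟩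

theorem QuadraticAlgebra.not_isSquare_neg_one_zmod_eight {c : ZMod 8} (hc : c * 4 = 4) :
    ¬ IsSquare (-1 : QuadraticAlgebra (ZMod 8) (-c) 1) := by
  have key : ∀ c : ZMod 8, c * 4 = 4 → ∀ a b : ZMod 8,
      (-1 : QuadraticAlgebra (ZMod 8) (-c) 1) ≠ ⟨a, b⟩ * ⟨a, b⟩ := by
    decide +kernel
  rintro ⟨z, hz⟩
  exact key c hc z.re z.im hz

/-- The `n`-th roots of unity of a commutative monoid, as elements of the monoid. -/
def rootsOfUnityEquivPowEqOne (M : Type*) [CommMonoid M] (n : ℕ) [NeZero n] :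
    rootsOfUnity n M ≃ {x : M // x ^ n = 1} where
  toFun ζ := ⟨(ζ : Mˣ), (mem_rootsOfUnity' n _).mp ζ.2⟩
  invFun x := rootsOfUnity.mkOfPowEq x.1 x.2
  left_inv _ := Subtype.ext (Units.ext rfl)
  right_inv _ := rfl

theorem QuadraticAlgebra.card_rootsOfUnity_two_zmod_eight {c : ZMod 8} (hc : c * 4 = 4) :
    Nat.card (rootsOfUnity 2 (QuadraticAlgebra (ZMod 8) (-c) 1)) = 8 := by
  have key : ∀ c : ZMod 8, c * 4 = 4 → Fintype.card {p : ZMod 8 × ZMod 8 //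
      (⟨p.1, p.2⟩ * ⟨p.1, p.2⟩ : QuadraticAlgebra (ZMod 8) (-c) 1) = 1} = 8 := by
    decide +kernel
  refine Eq.trans ?_ (Nat.card_eq_fintype_card.trans (key c hc))
  refine Nat.card_congr ((rootsOfUnityEquivPowEqOne _ 2).trans
    ((QuadraticAlgebra.equivProd _ _).subtypeEquiv fun z => ?_))
  rw [pow_two]
  rfl

/-- A ring with 64 elements containing a root of `X² - X + c`, with `c` odd, in which `8 = 0`
but `4 ≠ 0`, is the quadratic algebra over `ZMod 8` with this polynomial. -/
theorem nonempty_quadraticAlgebra_zmod_eight_ringEquiv {R : Type*} [CommRing R]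
    (hcard : Nat.card R = 64) (h8 : (8 : R) = 0) (h4 : (4 : R) ≠ 0) {c : ℕ}
    (hc : (c : ZMod 8) * 4 = 4) {w : R}
    (hw : w * w = w - c) :
    Nonempty (QuadraticAlgebra (ZMod 8) (-(c : ZMod 8)) 1 ≃+* R) := by
  have hfin : Finite R := Nat.finite_of_card_ne_zero (by omega)
  have hchar : CharP R 8 := by
    refine ringChar.of_eq ?_
    have hdvd : ringChar R ∣ 2 ^ 3 := ringChar.dvd (by exact_mod_cast h8)
    obtain ⟨k, hk, hk'⟩ := (Nat.dvd_prime_pow Nat.prime_two).mp hdvd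
    obtain rfl | hlt := hk.eq_or_lt
    · exact hk'
    · refine absurd ((ringChar.spec R 4).mpr ?_) (by exact_mod_cast h4)
      rw [hk']
      exact pow_dvd_pow 2 (Nat.le_of_lt_succ hlt)
  let _ : Algebra (ZMod 8) R := ZMod.algebra R 8
  have hw' : w * w = (-(c : ZMod 8)) • (1 : R) + (1 : ZMod 8) • w := by
    rw [hw, Algebra.smul_def, one_smul, map_neg, map_natCast]
    ring
  let φ := QuadraticAlgebra.lift ⟨w, hw'⟩
  have hinj : Function.Injective φ := by
    rw [injective_iff_map_eq_zero]
    intro z hz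
    by_contra hne
    obtain ⟨y, hy⟩ := QuadraticAlgebra.exists_mul_eq_four_zmod_eight hc hne
    apply h4
    rw [← map_ofNat φ, ← hy, map_mul, hz, zero_mul]
  refine ⟨RingEquiv.ofBijective φ ?_⟩
  refine (Nat.bijective_iff_injective_and_card φ).mpr ⟨hinj, ?_⟩
  rw [hcard, Nat.card_congr (QuadraticAlgebra.equivProd _ _)]
  simp

theorem exists_ringOfIntegers_mul_self_eq {K : Type*} [Field K] [NumberField K] {c : ℕ} {x : K}
    (hx : x ^ 2 = -((4 * c - 1 : ℤ) : K)) : ∃ w : 𝓞 K, w * w = w - c := by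
  have hw : ((1 + x) / 2) * ((1 + x) / 2) = (1 + x) / 2 - (c : K) := by
    push_cast at hx
    linear_combination hx / 4
  have hint : IsIntegral ℤ ((1 + x) / 2) := by
    refine ⟨.X ^ 2 - .X + Polynomial.C (c : ℤ), by monicity!, ?_⟩
    rw [Polynomial.eval₂_add, Polynomial.eval₂_sub, Polynomial.eval₂_pow,
      Polynomial.eval₂_X, Polynomial.eval₂_C, map_natCast]
    linear_combination hw
  obtain ⟨w, hwx⟩ := (IsIntegralClosure.isIntegral_iff (A := 𝓞 K)).mp hint
  refine ⟨w, FaithfulSMul.algebraMap_injective (𝓞 K) K ?_⟩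
  rw [map_mul, map_sub, map_natCast, hwx, hw]

theorem NumberField.RingOfIntegers.natCard_quotient_span_natCast {K : Type*} [Field K]
    [NumberField K] (n : ℕ) :
    Nat.card (𝓞 K ⧸ Ideal.span {(n : 𝓞 K)}) = n ^ Module.finrank ℚ K := by
  rw [← RingOfIntegers.rank K, ← Ideal.absNorm_span_natCast, Ideal.absNorm_apply,
    Submodule.cardQuot_apply]

theorem NumberField.RingOfIntegers.not_eight_dvd_four {K : Type*} [Field K] [NumberField K] :
    ¬ (8 : 𝓞 K) ∣ 4 := by
  rintro ⟨y, hy⟩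
  have h : (2 : 𝓞 K) * y = 1 := by
    apply mul_left_cancel₀ (OfNat.ofNat_ne_zero 4 : (4 : 𝓞 K) ≠ 0)
    linear_combination -hy
  have hnorm := congrArg (Algebra.norm ℤ) h
  rw [map_mul, map_one, ← map_ofNat (algebraMap ℤ (𝓞 K)) 2, Algebra.norm_algebraMap] at hnorm
  have h2 : (2 : ℤ) ∣ 1 := (dvd_pow_self 2 Module.finrank_pos.ne').trans ⟨_, hnorm.symm⟩
  omega

set_option maxSynthPendingDepth 2 in
/-- For `d ∈ {3, 11, 19, 43, 67, 163}` and `K = ℚ(√−d)`, let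
`Φ : 𝓞_Kˣ → (𝓞_K/8𝓞_K)ˣ/((𝓞_K/8𝓞_K)ˣ)²` be the homomorphism obtained by reducing units
modulo `8𝓞_K` and passing to the quotient by squares. Then the image of `Φ` has order 2 and
the cokernel of `Φ` is isomorphic to `(ℤ/2ℤ)²`; in particular the cokernel has order 4. -/
theorem image_and_cokernel_of_units_map
    (d : ℕ) (hd : d = 3 ∨ d = 11 ∨ d = 19 ∨ d = 43 ∨ d = 67 ∨ d = 163)
    (K : Type*) [Field K] [NumberField K] (hdeg : Module.finrank ℚ K = 2)
    (sqd : K) (hsqd : sqd ^ 2 = -(d : K)) :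
    let sq : Subgroup (𝓞 K ⧸ Ideal.span {(8 : 𝓞 K)})ˣ :=
      (powMonoidHom 2 : (𝓞 K ⧸ Ideal.span {(8 : 𝓞 K)})ˣ →*
        (𝓞 K ⧸ Ideal.span {(8 : 𝓞 K)})ˣ).range
    let Φ : (𝓞 K)ˣ →* (𝓞 K ⧸ Ideal.span {(8 : 𝓞 K)})ˣ ⧸ sq :=
      (QuotientGroup.mk' sq).comp
        (Units.map (Ideal.Quotient.mk (Ideal.span {(8 : 𝓞 K)})).toMonoidHom)
    Nat.card Φ.range = 2 ∧
      Nonempty ((((𝓞 K ⧸ Ideal.span {(8 : 𝓞 K)})ˣ ⧸ sq) ⧸ Φ.range) ≃*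
        Multiplicative (ZMod 2 × ZMod 2)) ∧
      Nat.card (((𝓞 K ⧸ Ideal.span {(8 : 𝓞 K)})ˣ ⧸ sq) ⧸ Φ.range) = 4 := by
  obtain ⟨c, hc, hcd⟩ : ∃ c : ℕ, (c : ZMod 8) * 4 = 4 ∧ d + 1 = 4 * c := by
    obtain rfl | rfl | rfl | rfl | rfl | rfl := hd
    exacts [⟨1, by decide, rfl⟩, ⟨3, by decide, rfl⟩, ⟨5, by decide, rfl⟩,
      ⟨11, by decide, rfl⟩, ⟨17, by decide, rfl⟩, ⟨41, by decide, rfl⟩]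
  obtain ⟨w, hw⟩ := exists_ringOfIntegers_mul_self_eq (c := c) (x := sqd) (by
    rw [hsqd, show (4 * c - 1 : ℤ) = d by omega, Int.cast_natCast])
  let I := Ideal.span {(8 : 𝓞 K)}
  let π := Ideal.Quotient.mk I
  have hcard : Nat.card (𝓞 K ⧸ I) = 64 := by
    have h := RingOfIntegers.natCard_quotient_span_natCast (K := K) 8
    rwa [hdeg] at h
  have hfin : Finite (𝓞 K ⧸ I) := Nat.finite_of_card_ne_zero (by omega)
  have h8 : (8 : 𝓞 K ⧸ I) = 0 := by
    rw [← map_ofNat π 8]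
    exact Ideal.Quotient.eq_zero_iff_mem.mpr (Ideal.mem_span_singleton_self _)
  have h4 : (4 : 𝓞 K ⧸ I) ≠ 0 := by
    rw [← map_ofNat π 4, Ne, Ideal.Quotient.eq_zero_iff_mem, Ideal.mem_span_singleton]
    exact RingOfIntegers.not_eight_dvd_four
  obtain ⟨e⟩ := nonempty_quadraticAlgebra_zmod_eight_ringEquiv hcard h8 h4 hc (w := π w) (by
    rw [← map_mul, hw, map_sub, map_natCast])
  have hneg : ¬ IsSquare (-1 : (𝓞 K ⧸ I)ˣ) := fun h => by
    apply QuadraticAlgebra.not_isSquare_neg_one_zmod_eight hc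
    have := (h.map (Units.coeHom _)).map e.symm
    simpa using this
  have hker : Nat.card (powMonoidHom 2 : (𝓞 K ⧸ I)ˣ →* (𝓞 K ⧸ I)ˣ).ker = 8 := by
    rw [← rootsOfUnity_eq_ker]
    exact (Nat.card_congr (e.toMulEquiv.restrictRootsOfUnity 2).toEquiv).symm.trans
      (QuadraticAlgebra.card_rootsOfUnity_two_zmod_eight hc)
  have hfneg : Units.map π.toMonoidHom (-1) = -1 := Units.ext (by simp [π])
  refine card_range_and_quotient_of_card_ker_sq (Units.map π.toMonoidHom) (-1)
    (by rwa [hfneg]) (NumberField.Units.exists_eq_sq_or_neg_sq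
      (NumberField.Units.rank_eq_zero_of_sq_eq_neg hdeg (by omega) hsqd) fun h => hneg ?_) hker
  rw [← hfneg]
  exact h.map _
end

section
/- Let d ∈ {3, 11, 19, 43, 67, 163}, let O_K be the ring of integers of K = Q(√−d), and let N = 16·O_K = (2O_K)⁴. Let Γ₀(N) be the subgroup of GL₂(O_K) consisting of those matrices whose lower-left entry lies in N. Then every element of finite order of Γ₀(N) has order dividing 6. -/
open NumberField Matrix

/-- The congruence subgroup `Γ₀(N)` of `GL₂(R)`: invertible matrices whose lower-left entry
lies in the ideal `N`. -/
def Gamma0 {R : Type*} [CommRing R] (N : Ideal R) : Subgroup (GL (Fin 2) R) where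
  carrier := {A | (A : Matrix (Fin 2) (Fin 2) R) 1 0 ∈ N}
  one_mem' := by
    simp [Matrix.one_apply]
  mul_mem' := by
    intro A B ha hb
    simp only [Set.mem_setOf_eq, Units.val_mul, Matrix.mul_apply, Fin.sum_univ_two] at *
    exact N.add_mem (Ideal.mul_mem_right _ N ha) (Ideal.mul_mem_left N _ hb)
  inv_mem' := by
    intro A ha
    simp only [Set.mem_setOf_eq] at *
    rw [Matrix.coe_units_inv, Matrix.inv_def, Matrix.smul_apply, Matrix.adjugate_fin_two,
      smul_eq_mul]
    exact Ideal.mul_mem_left N _ (by simpa using N.neg_mem ha)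


/-- A complex square root of a negative integer is purely imaginary. -/
lemma star_eq_neg_of_sq_eq_neg {d : ℕ} (hd : 0 < d) {w : ℂ} (hw : w ^ 2 = -(d : ℂ)) :
    star w = -w := by
  have hre : w.re * w.re - w.im * w.im = -(d : ℝ) := by
    simpa [pow_two] using congrArg Complex.re hw
  have him : w.re * w.im + w.im * w.re = 0 := by
    simpa [pow_two] using congrArg Complex.im hw
  have hd' : (0 : ℝ) < d := by exact_mod_cast hd
  have h0 : w.re = 0 := by
    by_contra h
    have : w.im = 0 := by
      have : w.re * w.im = 0 := by linarith
      exact (mul_eq_zero.mp this).resolve_left h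
    rw [this] at hre
    nlinarith [mul_self_nonneg w.re]
  apply Complex.ext <;> simp [h0]

/-- In a quadratic field containing `√-d`, every element is `x + y√-d` with `x, y` rational. -/
lemma exists_eq_add_mul_sqrt {d : ℕ} (hd : 0 < d) {K : Type*} [Field K] [NumberField K]
    (hdeg : Module.finrank ℚ K = 2) {s : K} (hs : s ^ 2 = -(d : K)) (a : K) :
    ∃ x y : ℚ, a = (x : K) + (y : K) * s := by
  have hli : LinearIndependent ℚ ![(1 : K), s] := by
    rw [LinearIndependent.pair_iff]
    intro u v h
    simp only [Rat.smul_def, mul_one] at h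
    have hv : v = 0 := by
      by_contra hv
      have h1 : ((u ^ 2 + d * v ^ 2 : ℚ) : K) = 0 := by
        push_cast
        linear_combination ((u : K) - v * s) * h + (v : K) ^ 2 * hs
      have h2 : u ^ 2 + d * v ^ 2 = 0 := by exact_mod_cast h1
      have : (0 : ℚ) < d := by exact_mod_cast hd
      have : 0 < v ^ 2 := by positivity
      nlinarith [sq_nonneg u, mul_pos ‹(0 : ℚ) < d› this]
    subst hv
    simpa using h
  have hspan := hli.span_eq_top_of_card_eq_finrank (by simp [hdeg])
  have ha : a ∈ Submodule.span ℚ (Set.range ![(1 : K), s]) := hspan ▸ Submodule.mem_top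
  simp only [Matrix.range_cons, Matrix.range_empty, Set.union_empty, Set.singleton_union,
    Submodule.mem_span_pair] at ha
  obtain ⟨x, y, h⟩ := ha
  exact ⟨x, y, by simpa [Rat.smul_def] using h.symm⟩

/-- A rational number which is integral over `ℤ` inside `ℂ` is an integer. -/
lemma exists_int_of_isIntegral_ratCast {q : ℚ} (h : IsIntegral ℤ (q : ℂ)) : ∃ n : ℤ, q = n := by
  have h' : IsIntegral ℤ q :=
    (isIntegral_algebraMap_iff (algebraMap ℚ ℂ).injective).mp (by simpa using h)
  obtain ⟨n, hn⟩ := IsIntegrallyClosed.isIntegral_iff.mp h'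
  exact ⟨n, by simpa using hn.symm⟩

/-- Complex conjugation preserves integrality over `ℤ`. -/
lemma isIntegral_star {z : ℂ} (h : IsIntegral ℤ z) : IsIntegral ℤ (star z) :=
  h.map (starRingEnd ℂ).toIntAlgHom

lemma exists_int_of_prime_mul_sq {d : ℕ} (hd : d.Prime) {q : ℚ} {k : ℤ} (h : d * q ^ 2 = k) :
    ∃ n : ℤ, q = n := by
  have hd0 : (d : ℚ) ≠ 0 := by exact_mod_cast hd.ne_zero
  have hintegral : IsIntegral ℤ ((d : ℚ) * q) := by
    refine IsIntegral.of_pow (n := 2) two_pos ?_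
    have : ((d : ℚ) * q) ^ 2 = algebraMap ℤ ℚ (d * k) := by
      simp only [algebraMap_int_eq, eq_intCast, Int.cast_mul, Int.cast_natCast, ← h]
      ring
    rw [this]
    exact isIntegral_algebraMap
  obtain ⟨m, hm⟩ := IsIntegrallyClosed.isIntegral_iff.mp hintegral
  simp only [algebraMap_int_eq, eq_intCast] at hm
  have hmk : m ^ 2 = d * k := by
    have : (m : ℚ) ^ 2 = d * k := by rw [hm, ← h]; ring
    exact_mod_cast this
  obtain ⟨n, rfl⟩ := (Nat.prime_iff_prime_int.mp hd).dvd_of_dvd_pow (Dvd.intro _ hmk.symm)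
  refine ⟨n, mul_left_cancel₀ hd0 ?_⟩
  rw [← hm]
  push_cast
  rfl

/-- Integers of `ℚ(√-d)`, `d` prime, have half-integral coordinates, and integral norm. -/
lemma exists_half_int_coords {d : ℕ} (hd : d.Prime) {K : Type*} [Field K] [NumberField K]
    (hdeg : Module.finrank ℚ K = 2) {s : K} (hs : s ^ 2 = -(d : K)) (a : 𝓞 K) :
    ∃ t y n : ℤ, 2 * (a : K) = t + y * s ∧ t ^ 2 + d * y ^ 2 = 4 * n := by
  obtain ⟨φ⟩ : Nonempty (K →+* ℂ) := inferInstance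
  obtain ⟨x, y, ha⟩ := exists_eq_add_mul_sqrt hd.pos hdeg hs (a : K)
  have hw : φ s ^ 2 = -(d : ℂ) := by rw [← map_pow, hs]; simp
  have hstar := star_eq_neg_of_sq_eq_neg hd.pos hw
  have hz : φ (a : K) = x + y * φ s := by rw [ha]; simp
  have hz' : star (φ (a : K)) = x - y * φ s := by
    rw [hz, star_add, star_mul', hstar]
    simp [sub_eq_add_neg]
  have hintegral : IsIntegral ℤ (φ (a : K)) := (RingOfIntegers.isIntegral_coe a).map φ.toIntAlgHom
  have hintegral' := isIntegral_star hintegral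
  obtain ⟨t, ht⟩ := exists_int_of_isIntegral_ratCast (q := 2 * x) (by
    have h : ((2 * x : ℚ) : ℂ) = φ (a : K) + star (φ (a : K)) := by
      rw [hz', hz]; push_cast; ring
    exact h ▸ hintegral.add hintegral')
  obtain ⟨n, hn⟩ := exists_int_of_isIntegral_ratCast (q := x ^ 2 + d * y ^ 2) (by
    have h : ((x ^ 2 + d * y ^ 2 : ℚ) : ℂ) = φ (a : K) * star (φ (a : K)) := by
      rw [hz', hz]; push_cast; linear_combination (y : ℂ) ^ 2 * hw
    exact h ▸ hintegral.mul hintegral')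
  obtain ⟨Y, hY⟩ := exists_int_of_prime_mul_sq hd (q := 2 * y) (k := 4 * n - t ^ 2) (by
    push_cast
    rw [← ht, ← hn]; ring)
  refine ⟨t, Y, n, ?_, ?_⟩
  · have h1 : (2 : K) * x = t := by exact_mod_cast congrArg (Rat.cast : ℚ → K) ht
    have h2 : (2 : K) * y = Y := by exact_mod_cast congrArg (Rat.cast : ℚ → K) hY
    rw [ha, ← h1, ← h2]; ring
  · have : (t : ℚ) ^ 2 + d * Y ^ 2 = 4 * n := by rw [← ht, ← hY, ← hn]; ring
    exact_mod_cast this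

/-- The coordinates of an element of `K` with respect to `1, √-d` are unique. -/
lemma int_coords_unique {d : ℕ} (hd : 0 < d) {K : Type*} [Field K] [CharZero K] {s : K}
    (hs : s ^ 2 = -(d : K)) {u v : ℤ} (h : (u : K) + v * s = 0) : u = 0 ∧ v = 0 := by
  have h1 : u ^ 2 + d * v ^ 2 = 0 := by
    have : (u : K) ^ 2 + d * v ^ 2 = 0 := by
      linear_combination ((u : K) - v * s) * h + (v : K) ^ 2 * hs
    exact_mod_cast this
  have hd' : (0 : ℤ) < d := by exact_mod_cast hd
  have hv : v = 0 := by
    by_contra hv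
    have : 0 < v ^ 2 := by positivity
    nlinarith [sq_nonneg u, mul_pos hd' this]
  subst hv
  simpa using h1

lemma int_sq_sub_mul_sq_ne {d t y T Y n m : ℤ} (hd : d % 4 = 3) (hn : t ^ 2 + d * y ^ 2 = 4 * n)
    (hm : T ^ 2 + d * Y ^ 2 = 4 * m) (h1 : t ^ 2 - d * y ^ 2 + 4 = 8 * T) (h2 : t * y = 4 * Y) :
    False := by
  obtain ⟨e, rfl⟩ : ∃ e, d = 4 * e + 3 := ⟨d / 4, by omega⟩
  rcases Int.even_or_odd' t with ⟨a, rfl | rfl⟩ <;> rcases Int.even_or_odd' y with ⟨b, rfl | rfl⟩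
  · have hY : Y = a * b := by linarith
    have hT : 2 * T = a ^ 2 - (4 * e + 3) * b ^ 2 + 1 := by linarith
    rcases Int.even_or_odd' a with ⟨a, rfl | rfl⟩ <;>
      rcases Int.even_or_odd' b with ⟨b, rfl | rfl⟩ <;>
      rcases Int.even_or_odd' T with ⟨T, rfl | rfl⟩ <;> subst hY <;> ring_nf at * <;> omega
  all_goals ring_nf at * ; omega

/-- `-1` is not a square modulo `4` in the ring of integers of `ℚ(√-d)`, `d ≡ 3 mod 4` prime. -/
lemma sq_add_one_ne_four_mul {d : ℕ} (hd : d.Prime) (hd4 : d % 4 = 3) {K : Type*} [Field K]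
    [NumberField K] (hdeg : Module.finrank ℚ K = 2) {s : K} (hs : s ^ 2 = -(d : K))
    (a e : 𝓞 K) : a ^ 2 + 1 ≠ 4 * e := by
  intro h
  obtain ⟨t, y, n, ha, hn⟩ := exists_half_int_coords hd hdeg hs a
  obtain ⟨T, Y, m, he, hm⟩ := exists_half_int_coords hd hdeg hs e
  have hK : (a : K) ^ 2 + 1 = 4 * (e : K) := by
    simpa only [map_add, map_pow, map_mul, map_one, map_ofNat] using
      congrArg (algebraMap (𝓞 K) K) h
  have h0 : ((t ^ 2 - d * y ^ 2 + 4 - 8 * T : ℤ) : K) +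
      ((2 * (t * y - 4 * Y) : ℤ) : K) * s = 0 := by
    push_cast
    linear_combination 4 * hK - (2 * (a : K) + t + y * s) * ha + 8 * he - (y : K) ^ 2 * hs
  obtain ⟨h1, h2⟩ := int_coords_unique hd.pos hs h0
  exact int_sq_sub_mul_sq_ne (d := d) (by omega) hn hm (by linarith) (by linarith)

/-- A complex `2 × 2` matrix of determinant one and finite order has real trace in `[-2, 2]`. -/
lemma exists_trace_eq_of_pow_eq_one {C : Matrix (Fin 2) (Fin 2) ℂ} (hdet : C.det = 1) {n : ℕ}
    (hn : n ≠ 0) (hC : C ^ n = 1) : ∃ r : ℝ, C.trace = r ∧ |r| ≤ 2 := by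
  obtain ⟨z, hz⟩ := IsAlgClosed.exists_root C.charpoly (by simp [Matrix.charpoly_degree_eq_dim])
  have hspec : z ∈ spectrum ℂ C := Matrix.mem_spectrum_iff_isRoot_charpoly.mpr hz
  have hpow : z ^ n = 1 := by
    have := spectrum.pow_mem_pow C n hspec
    rwa [hC, spectrum.one_eq, Set.mem_singleton_iff] at this
  have hnorm : ‖z‖ = 1 := Complex.norm_eq_one_of_pow_eq_one hpow hn
  have hroot : z ^ 2 - C.trace * z + 1 = 0 := by
    simpa [Matrix.charpoly_fin_two, hdet] using hz
  have hconj : z * star z = 1 := by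
    have := Complex.mul_conj' z
    rw [hnorm] at this
    simpa using this
  have htr : C.trace = z + star z := by
    linear_combination (z - C.trace) * hconj - star z * hroot
  refine ⟨2 * z.re, ?_, ?_⟩
  · rw [htr]
    apply Complex.ext <;> simp [two_mul]
  · rw [abs_mul, abs_two]
    linarith [Complex.abs_re_le_norm z]

/-- A torsion unipotent `2 × 2` matrix over a domain of characteristic zero is trivial. -/
lemma eq_one_of_sub_one_sq_eq_zero {R : Type*} [CommRing R] [IsDomain R] [CharZero R]
    {C : Matrix (Fin 2) (Fin 2) R} (h : (C - 1) ^ 2 = 0) {n : ℕ} (hn : n ≠ 0) (hC : C ^ n = 1) :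
    C = 1 := by
  have key : ∀ k : ℕ, C ^ k = 1 + k • (C - 1) := by
    intro k
    induction k with
    | zero => simp
    | succ k ih =>
      have : C ^ (k + 1) = 1 + (k + 1) • (C - 1) + k • (C - 1) ^ 2 := by
        rw [pow_succ, ih, pow_two]
        simp only [add_mul, one_mul, smul_mul_assoc, mul_sub, sub_mul, mul_one, add_smul, one_smul,
          smul_sub]
        abel
      rw [this, h, smul_zero, add_zero]
  have h0 : n • (C - 1) = 0 := by simpa [hC] using (key n).symm
  ext i j
  have := congrFun (congrFun h0 i) j
  simp only [Matrix.smul_apply, Matrix.zero_apply, Matrix.sub_apply, nsmul_eq_mul,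
    mul_eq_zero, Nat.cast_eq_zero, hn, false_or] at this
  exact sub_eq_zero.mp this

/-- The trace of a torsion element of `SL₂(𝓞 K)`, `K` imaginary quadratic, is an integer in
`[-2, 2]`. -/
lemma exists_int_trace {d : ℕ} (hd : d.Prime) {K : Type*} [Field K] [NumberField K]
    (hdeg : Module.finrank ℚ K = 2) {s : K} (hs : s ^ 2 = -(d : K))
    {C : Matrix (Fin 2) (Fin 2) (𝓞 K)} (hdet : C.det = 1) {n : ℕ} (hn : n ≠ 0) (hC : C ^ n = 1) :
    ∃ t : ℤ, C.trace = t ∧ |t| ≤ 2 := by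
  obtain ⟨φ⟩ : Nonempty (K →+* ℂ) := inferInstance
  let ψ : 𝓞 K →+* ℂ := φ.comp (algebraMap (𝓞 K) K)
  obtain ⟨r, hr, hr2⟩ := exists_trace_eq_of_pow_eq_one (C := ψ.mapMatrix C)
    (by rw [← RingHom.map_det, hdet, map_one]) hn (by rw [← map_pow, hC, map_one])
  have hr' : ψ C.trace = r := by
    rw [← hr, Matrix.trace_fin_two, Matrix.trace_fin_two]
    simp
  obtain ⟨x, y, ha⟩ := exists_eq_add_mul_sqrt hd.pos hdeg hs (C.trace : K)
  have hw : φ s ^ 2 = -(d : ℂ) := by rw [← map_pow, hs]; simp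
  have hstar := star_eq_neg_of_sq_eq_neg hd.pos hw
  have hw0 : φ s ≠ 0 := by
    intro h
    rw [h] at hw
    simp [hd.ne_zero] at hw
  have hz : (r : ℂ) = x + y * φ s := by
    rw [← hr']
    change φ (C.trace : K) = _
    rw [ha]; simp
  have hz' : (r : ℂ) = x - y * φ s := by
    have := congrArg star hz
    rw [star_add, star_mul', hstar] at this
    simpa [sub_eq_add_neg] using this
  have hy : (y : ℂ) = 0 := by
    have : (y : ℂ) * φ s = 0 := by linear_combination (hz' - hz) / 2
    exact (mul_eq_zero.mp this).resolve_right hw0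
  have hrx : (r : ℂ) = x := by rw [hz, hy]; simp
  obtain ⟨t, ht⟩ := exists_int_of_isIntegral_ratCast (q := x) (by
    rw [← hrx, ← hr']
    exact (RingOfIntegers.isIntegral C.trace).map ψ.toIntAlgHom)
  refine ⟨t, ?_, ?_⟩
  · have : Function.Injective ψ := φ.injective.comp RingOfIntegers.coe_injective
    apply this
    rw [hr', hrx, ht]
    simp
  · have : r = t := by
      have : (r : ℂ) = (t : ℂ) := by rw [hrx, ht]; simp
      exact_mod_cast this
    rw [this] at hr2
    exact_mod_cast hr2

/-- Classification of torsion in `SL₂(𝓞 K)` for `K` imaginary quadratic. -/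
lemma torsion_of_det_eq_one {d : ℕ} (hd : d.Prime) {K : Type*} [Field K] [NumberField K]
    (hdeg : Module.finrank ℚ K = 2) {s : K} (hs : s ^ 2 = -(d : K))
    {C : Matrix (Fin 2) (Fin 2) (𝓞 K)} (hdet : C.det = 1) {n : ℕ} (hn : n ≠ 0) (hC : C ^ n = 1) :
    C ^ 3 = 1 ∨ C ^ 2 = -1 ∨ C = -1 ∨ C ^ 3 = -1 := by
  obtain ⟨t, ht, ht2⟩ := exists_int_trace hd hdeg hs hdet hn hC
  have hCH : C ^ 2 = (t : 𝓞 K) • C - 1 := by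
    have h := C.aeval_self_charpoly
    rw [Matrix.charpoly_fin_two, hdet, ht] at h
    simp only [map_add, map_sub, map_mul, map_pow, Polynomial.aeval_X, Polynomial.aeval_C,
      map_one, ← Algebra.smul_def] at h
    rw [sub_add, sub_eq_zero] at h
    exact h
  obtain ⟨h1, h2⟩ := abs_le.mp ht2
  interval_cases t
  · right; right; left
    have : -C = 1 := by
      refine eq_one_of_sub_one_sq_eq_zero (n := 2 * n) ?_ (by omega) ?_
      · have : (-C - 1) ^ 2 = C ^ 2 + (C + C) + 1 := by noncomm_ring
        rw [this, hCH]
        push_cast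
        rw [neg_smul, two_smul]
        abel
      · rw [pow_mul, neg_sq, ← pow_mul, mul_comm, pow_mul, hC, one_pow]
    rw [← this, neg_neg]
  · left
    have h : C ^ 2 = -C - 1 := by simpa using hCH
    have : C ^ 3 = C * C ^ 2 := by rw [pow_succ']
    rw [this, h, mul_sub, mul_neg, ← pow_two, h]
    simp
  · right; left
    simpa using hCH
  · right; right; right
    have h : C ^ 2 = C - 1 := by simpa using hCH
    have : C ^ 3 = C * C ^ 2 := by rw [pow_succ']
    rw [this, h, mul_sub, ← pow_two, h]
    simp
  · left
    have : C = 1 := by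
      refine eq_one_of_sub_one_sq_eq_zero (n := n) ?_ hn hC
      have : (C - 1) ^ 2 = C ^ 2 - (C + C) + 1 := by noncomm_ring
      rw [this, hCH]
      push_cast
      rw [two_smul]
      abel
    rw [this, one_pow]

/-- A root of unity of `ℚ(√-d)`, `d ≡ 3 mod 4` prime, is a sixth root of unity. -/
lemma pow_six_eq_one_of_pow_eq_one {d : ℕ} (hd : d.Prime) (hd4 : d % 4 = 3) {K : Type*} [Field K]
    [NumberField K] (hdeg : Module.finrank ℚ K = 2) {s : K} (hs : s ^ 2 = -(d : K))
    {u : 𝓞 K} {n : ℕ} (hn : n ≠ 0) (hu : u ^ n = 1) : u ^ 6 = 1 := by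
  obtain ⟨v, huv⟩ : ∃ v, u * v = 1 := ⟨u ^ (n - 1), by rw [mul_pow_sub_one hn, hu]⟩
  have hv : v ^ n = 1 := by simpa [mul_pow, hu] using congrArg (· ^ n) huv
  have key := torsion_of_det_eq_one hd hdeg hs (C := Matrix.diagonal ![u, v])
    (by simpa [Matrix.det_diagonal] using huv) hn (by
      rw [Matrix.diagonal_pow, ← Matrix.diagonal_one]
      congr 1
      ext i
      fin_cases i <;> simp [hu, hv])
  simp only [Matrix.diagonal_pow] at key
  rcases key with h | h | h | h <;> have h0 := congrFun (congrFun h 0) 0 <;> simp at h0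
  · linear_combination (u ^ 3 + 1) * h0
  · exact absurd (by rw [h0]; simp) (sq_add_one_ne_four_mul hd hd4 hdeg hs u 0)
  · rw [h0]; ring
  · linear_combination (u ^ 3 - 1) * h0

/-- No square root of `-1` in `M₂(𝓞 K)` is upper triangular modulo `16`. -/
lemma sq_ne_neg_one {d : ℕ} (hd : d.Prime) (hd4 : d % 4 = 3) {K : Type*} [Field K]
    [NumberField K] (hdeg : Module.finrank ℚ K = 2) {s : K} (hs : s ^ 2 = -(d : K))
    {B : Matrix (Fin 2) (Fin 2) (𝓞 K)} (hB : B 1 0 ∈ Ideal.span {(16 : 𝓞 K)}) : B ^ 2 ≠ -1 := by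
  intro h
  obtain ⟨c, hc⟩ := Ideal.mem_span_singleton.mp hB
  have h0 := congrFun (congrFun h 0) 0
  simp only [pow_two, Matrix.mul_apply, Fin.sum_univ_two, Matrix.neg_apply, Matrix.one_apply_eq,
    hc] at h0
  exact sq_add_one_ne_four_mul hd hd4 hdeg hs (B 0 0) (-4 * B 0 1 * c) (by linear_combination h0)

/-- For `d ∈ {3, 11, 19, 43, 67, 163}`, `K = ℚ(√−d)` and
`N = 16𝓞_K = (2𝓞_K)⁴`, every element of finite order of `Γ₀(N)` has order dividing 6. -/
theorem torsion_of_Gamma0_divides_six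
    (d : ℕ) (hd : d = 3 ∨ d = 11 ∨ d = 19 ∨ d = 43 ∨ d = 67 ∨ d = 163)
    (K : Type*) [Field K] [NumberField K] (hdeg : Module.finrank ℚ K = 2)
    (sqd : K) (hsqd : sqd ^ 2 = -(d : K)) :
    ∀ A : Gamma0 (Ideal.span {(16 : 𝓞 K)}), IsOfFinOrder A → orderOf A ∣ 6 := by
  intro A hA
  have hp : d.Prime := by rcases hd with rfl | rfl | rfl | rfl | rfl | rfl <;> norm_num
  have hd4 : d % 4 = 3 := by omega
  obtain ⟨n, hn, hAn⟩ := isOfFinOrder_iff_pow_eq_one.mp hA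
  have coe_pow : ∀ k : ℕ, (((A ^ k : Gamma0 (Ideal.span {(16 : 𝓞 K)})) : GL (Fin 2) (𝓞 K)) :
      Matrix (Fin 2) (Fin 2) (𝓞 K)) = ((A : GL (Fin 2) (𝓞 K)) : Matrix _ _ _) ^ k := fun k => by
    simp
  have hMn := coe_pow n
  have hM3 : ((A : GL (Fin 2) (𝓞 K)) ^ 3 : Matrix (Fin 2) (Fin 2) (𝓞 K)) 1 0 ∈
      Ideal.span {(16 : 𝓞 K)} := by
    rw [← coe_pow]
    exact (A ^ 3).2
  have hM1 : ((A : GL (Fin 2) (𝓞 K)) : Matrix (Fin 2) (Fin 2) (𝓞 K)) 1 0 ∈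
      Ideal.span {(16 : 𝓞 K)} := A.2
  have hM2 : ((A : GL (Fin 2) (𝓞 K)) ^ 2 : Matrix (Fin 2) (Fin 2) (𝓞 K)) 1 0 ∈
      Ideal.span {(16 : 𝓞 K)} := by
    rw [← coe_pow]
    exact (A ^ 2).2
  rw [hAn] at hMn
  rw [orderOf_dvd_iff_pow_eq_one]
  suffices h6 : ((A : GL (Fin 2) (𝓞 K)) : Matrix (Fin 2) (Fin 2) (𝓞 K)) ^ 6 = 1 by
    apply Subtype.ext
    apply Units.ext
    rw [coe_pow, h6]
    rfl
  generalize ((A : GL (Fin 2) (𝓞 K)) : Matrix (Fin 2) (Fin 2) (𝓞 K)) = M at *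
  replace hMn : M ^ n = 1 := hMn.symm
  have hu : M.det ^ 6 = 1 := pow_six_eq_one_of_pow_eq_one hp hd4 hdeg hsqd hn.ne'
    (by rw [← Matrix.det_pow, hMn, Matrix.det_one])
  have hpow : ∀ k : ℕ, (M.det • M) ^ k = M.det ^ k • M ^ k := fun k => smul_pow _ _ _
  have hB6 : (M.det • M) ^ 6 = M ^ 6 := by rw [hpow, hu, one_smul]
  have key := torsion_of_det_eq_one hp hdeg hsqd (C := (M.det • M) ^ 2)
    (by
      rw [Matrix.det_pow, Matrix.det_smul, Fintype.card_fin]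
      linear_combination hu)
    (n := 3 * n) (by omega) (by
      rw [← pow_mul, show 2 * (3 * n) = 6 * n by ring, pow_mul, hB6, ← pow_mul, mul_comm, pow_mul,
        hMn, one_pow])
  rw [← hB6]
  rcases key with h | h | h | h
  · rwa [← pow_mul] at h
  · refine absurd h (sq_ne_neg_one hp hd4 hdeg hsqd ?_)
    rw [hpow]
    exact Ideal.mul_mem_left _ _ hM2
  · refine absurd h (sq_ne_neg_one hp hd4 hdeg hsqd ?_)
    exact Ideal.mul_mem_left _ _ hM1
  · rw [← pow_mul, mul_comm, pow_mul] at h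
    refine absurd h (sq_ne_neg_one hp hd4 hdeg hsqd ?_)
    rw [hpow]
    exact Ideal.mul_mem_left _ _ hM3
end
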